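/- Every regular incline is commutative: if R is an incline in which every element is regular, then x*y = y*x for all x, y in R. -/

import Mathlib

/-- An incline: a nonempty set with `+` and `*` such that `(R,+)` is a commutative
semigroup, `(R,*)` is a semigroup, `*` distributes over `+` from both sides,
addition is idempotent, and `x + x*y = x`, `x + y*x = x` for all `x y`.
(Nonemptiness is assumed via `Nonempty R` where needed.) -/
class Incline (R : Type*) extends Add R, Mul R where
  add_comm : ∀ x y : R, x + y = y + x
  add_assoc : ∀ x y z : R, x + y + z = x + (y + z)
  mul_assoc : ∀ x y z : R, x * y * z = x * (y * z)
  left_distrib : ∀ x y z : R, x * (y + z) = x * y + x * z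
  right_distrib : ∀ x y z : R, (x + y) * z = x * z + y * z
  add_idem : ∀ x : R, x + x = x
  add_absorb_mul_left : ∀ x y : R, x + x * y = x
  add_absorb_mul_right : ∀ x y : R, x + y * x = x

/-- An element `a` of an incline is regular if `a * z * a = a` for some `z`. -/
def Incline.IsRegular {R : Type*} [Incline R] (a : R) : Prop :=
  ∃ z : R, a * z * a = a

namespace Incline

variable {R : Type*} [Incline R]

theorem IsRegular.mul_self {a : R} (h : IsRegular a) : a * a = a := by
  obtain ⟨z, hz⟩ := h
  calc a * a = (a + a * z) * a := by rw [add_absorb_mul_left]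
    _ = a * a + a := by rw [right_distrib, hz]
    _ = a := by rw [Incline.add_comm, add_absorb_mul_left]

theorem add_mul_mul_absorb (a x y : R) : a + x * a * y = a := by
  calc a + x * a * y = a + x * a + x * a * y := by rw [add_absorb_mul_right]
    _ = a := by rw [Incline.add_assoc, add_absorb_mul_left, add_absorb_mul_right]

theorem mul_add_mul_swap_of_isRegular {x y : R} (h : IsRegular (x * y)) :
    y * x + x * y = y * x := by
  have hxy : x * (y * x) * y = x * y := by
    rw [← Incline.mul_assoc, Incline.mul_assoc, h.mul_self]
  simpa only [hxy] using add_mul_mul_absorb (y * x) x y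

end Incline

theorem regular_incline_comm {R : Type*} [Incline R] [Nonempty R]
    (hreg : ∀ a : R, Incline.IsRegular a) :
    ∀ x y : R, x * y = y * x := by
  intro x y
  rw [← Incline.mul_add_mul_swap_of_isRegular (hreg (x * y)), Incline.add_comm,
    Incline.mul_add_mul_swap_of_isRegular (hreg (y * x))]
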